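/- For every r ∈ ℕ_0 and every n ≥ 1, the probability that in the Plancherel growth process the box added at step n lies in row r satisfies ℙ(E_r^{(n)}) ≤ 1/√n. -/

import Mathlib

open MeasureTheory Filter

/-- The number of standard Young tableaux of shape `μ`: bijective fillings of the cells of `μ`
by `0, 1, …, μ.card - 1` that are strictly increasing along rows and columns. -/
noncomputable def sytCount (μ : YoungDiagram) : ℕ :=
  Nat.card {T : μ.cells → Fin μ.card //
    Function.Bijective T ∧
      ∀ a b : μ.cells, (a : ℕ × ℕ).1 ≤ (b : ℕ × ℕ).1 → (a : ℕ × ℕ).2 ≤ (b : ℕ × ℕ).2 →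
        a ≠ b → T a < T b}

/-- `lam 0 ↗ lam 1 ↗ ⋯` is a Plancherel growth process: the probability of any prescribed
initial path `∅ = μ⁽⁰⁾ ↗ μ⁽¹⁾ ↗ ⋯ ↗ μ⁽ⁿ⁾` in the Young graph equals `d_{μ⁽ⁿ⁾} / n!`,
which characterizes the distribution of the sequence of RSK shapes of an i.i.d. uniform
sequence. -/
def IsPlancherelGrowthProcess {Ω : Type*} [MeasurableSpace Ω] (P : Measure Ω)
    (lam : ℕ → Ω → YoungDiagram) : Prop :=
  IsProbabilityMeasure P ∧
  (∀ (n : ℕ) (y : YoungDiagram), MeasurableSet {ω | lam n ω = y}) ∧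
  ∀ (n : ℕ) (path : ℕ → YoungDiagram), path 0 = ⊥ →
    (∀ i, i < n → path i ≤ path (i + 1) ∧ (path (i + 1)).card = (path i).card + 1) →
    P {ω | ∀ i ≤ n, lam i ω = path i} =
      (sytCount (path n) : ENNReal) / (Nat.factorial n : ENNReal)

/-- The event `E_r⁽ⁿ⁺¹⁾` that the box added in step `n+1` of the growth process
(i.e. the unique box of `λ⁽ⁿ⁺¹⁾ ∖ λ⁽ⁿ⁾`) lies in the row with index `r`. -/
def growthEvent {Ω : Type*} (lam : ℕ → Ω → YoungDiagram) (n r : ℕ) : Set Ω :=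
  {ω | (lam (n + 1) ω).rowLen r = (lam n ω).rowLen r + 1}

namespace PGP
open Finset

lemma finite_level (n : ℕ) : {μ : YoungDiagram | μ.card = n}.Finite := by
  have hinj : Function.Injective YoungDiagram.cells := by
    intro a b h; exact YoungDiagram.ext h
  refine Set.Finite.subset (Set.Finite.preimage (f := YoungDiagram.cells) hinj.injOn
    (((Finset.range n ×ˢ Finset.range n).powerset).finite_toSet)) ?_
  intro μ hμ
  simp only [Set.mem_ofPred_eq] at hμ
  simp only [Set.mem_preimage, Finset.coe_powerset, Set.mem_powerset_iff, Finset.coe_subset]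
  rintro ⟨i, j⟩ hij
  have hij' : (i, j) ∈ μ := hij
  simp only [Finset.mem_product, Finset.mem_range]
  constructor
  · have : (Finset.range (i+1)).card ≤ μ.cells.card := by
      refine Finset.card_le_card_of_injOn (fun k => (k, j)) ?_ ?_
      · intro k hk
        have hk' : k < i + 1 := by simpa using hk
        exact μ.up_left_mem (by omega) le_rfl hij'
      · intro a _ b _ h; simpa using h
    have h2 : μ.cells.card = n := hμ
    simp at this; omega
  · have : (Finset.range (j+1)).card ≤ μ.cells.card := by
      refine Finset.card_le_card_of_injOn (fun k => (i, k)) ?_ ?_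
      · intro k hk
        have hk' : k < j + 1 := by simpa using hk
        exact μ.up_left_mem le_rfl (by omega) hij'
      · intro a _ b _ h; simpa using h
    have h2 : μ.cells.card = n := hμ
    simp at this; omega

noncomputable def Y (n : ℕ) : Finset YoungDiagram := (finite_level n).toFinset

lemma mem_Y {n : ℕ} {μ : YoungDiagram} : μ ∈ Y n ↔ μ.card = n := by simp [Y]

open Classical in
noncomputable def U (μ : YoungDiagram) : Finset YoungDiagram :=
  (Y (μ.card + 1)).filter (fun Λ => μ ≤ Λ)

open Classical in
noncomputable def D (Λ : YoungDiagram) : Finset YoungDiagram :=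
  (Y (Λ.card - 1)).filter (fun μ => μ ≤ Λ ∧ Λ.card = μ.card + 1)

lemma mem_U {μ Λ : YoungDiagram} : Λ ∈ U μ ↔ μ ≤ Λ ∧ Λ.card = μ.card + 1 := by
  simp [U, mem_Y, and_comm]

lemma mem_D {μ Λ : YoungDiagram} : μ ∈ D Λ ↔ μ ≤ Λ ∧ Λ.card = μ.card + 1 := by
  simp only [D, mem_Y, Finset.mem_filter]
  constructor
  · exact fun h => h.2
  · exact fun h => ⟨by omega, h⟩

lemma mem_D_iff {μ Λ : YoungDiagram} : μ ∈ D Λ ↔ Λ ∈ U μ := by rw [mem_D, mem_U]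

lemma cover_cell {μ Λ : YoungDiagram} (h : Λ ∈ U μ) :
    ∃ c, c ∉ μ ∧ Λ.cells = insert c μ.cells := by
  rw [mem_U] at h
  have hs : μ.cells ⊆ Λ.cells := h.1
  have hc : Λ.cells.card = μ.cells.card + 1 := h.2
  have h1 : (Λ.cells \ μ.cells).card = 1 := by
    rw [Finset.card_sdiff_of_subset hs]; omega
  obtain ⟨c, hc1⟩ := Finset.card_eq_one.mp h1
  have hcm : c ∈ Λ.cells \ μ.cells := by rw [hc1]; simp
  refine ⟨c, fun hh => (Finset.mem_sdiff.mp hcm).2 hh, ?_⟩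
  rw [← Finset.sdiff_union_of_subset hs, hc1]; rfl

lemma cover_of_mem {μ Λ : YoungDiagram} (h : Λ ∈ U μ) {c : ℕ × ℕ} (h1 : c ∉ μ) (h2 : c ∈ Λ) :
    Λ.cells = insert c μ.cells := by
  obtain ⟨d, hd, he⟩ := cover_cell h
  have : c ∈ Λ.cells := h2
  rw [he, Finset.mem_insert] at this
  rcases this with rfl | h3
  · exact he
  · exact absurd h3 h1

/-! rows -/
lemma row_cover {μ Λ : YoungDiagram} (h : Λ ∈ U μ) {r : ℕ} (hr : Λ.rowLen r = μ.rowLen r + 1) :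
    Λ.cells = insert (r, μ.rowLen r) μ.cells := by
  apply cover_of_mem h
  · rw [YoungDiagram.mem_iff_lt_rowLen]; omega
  · rw [YoungDiagram.mem_iff_lt_rowLen]; omega

lemma row_up_unique {μ Λ Λ' : YoungDiagram} (h : Λ ∈ U μ) (h' : Λ' ∈ U μ) {r : ℕ}
    (hr : Λ.rowLen r = μ.rowLen r + 1) (hr' : Λ'.rowLen r = μ.rowLen r + 1) : Λ = Λ' := by
  apply YoungDiagram.ext
  rw [row_cover h hr, row_cover h' hr']

lemma row_down_unique {μ μ' Λ : YoungDiagram} (h : Λ ∈ U μ) (h' : Λ ∈ U μ') {r : ℕ}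
    (hr : Λ.rowLen r = μ.rowLen r + 1) (hr' : Λ.rowLen r = μ'.rowLen r + 1) : μ = μ' := by
  have e : μ.rowLen r = μ'.rowLen r := by omega
  have h1 := row_cover h hr
  have h2 := row_cover h' hr'
  apply YoungDiagram.ext
  have n1 : (r, μ.rowLen r) ∉ μ.cells := by
    rw [YoungDiagram.mem_cells, YoungDiagram.mem_iff_lt_rowLen]; omega
  have n2 : (r, μ.rowLen r) ∉ μ'.cells := by
    rw [YoungDiagram.mem_cells, YoungDiagram.mem_iff_lt_rowLen]; omega
  rw [← Finset.erase_insert n1, ← Finset.erase_insert n2, ← h1, h2, e]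

/-- adding a box in row r -/
def addRow (μ : YoungDiagram) (r : ℕ) (h : r = 0 ∨ μ.rowLen r < μ.rowLen (r-1)) :
    YoungDiagram where
  cells := insert (r, μ.rowLen r) μ.cells
  isLowerSet := by
    rintro ⟨a, b⟩ ⟨c, d⟩ hle hm
    have hle1 : c ≤ a := hle.1
    have hle2 : d ≤ b := hle.2
    simp only [Finset.coe_insert, Set.mem_insert_iff, Prod.mk.injEq, Finset.mem_coe,
      YoungDiagram.mem_cells] at hm ⊢
    rcases hm with ⟨rfl, rfl⟩ | hm
    · by_cases hc : c = a
      · subst hc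
        rw [YoungDiagram.mem_iff_lt_rowLen]
        omega
      · right
        have := μ.rowLen_anti c (a-1) (by omega)
        rw [YoungDiagram.mem_iff_lt_rowLen]
        omega
    · right; exact μ.up_left_mem hle1 hle2 hm

def remRow (μ : YoungDiagram) (r : ℕ) (h : μ.rowLen (r+1) < μ.rowLen r) :
    YoungDiagram where
  cells := μ.cells.erase (r, μ.rowLen r - 1)
  isLowerSet := by
    rintro ⟨a, b⟩ ⟨c, d⟩ hle hm
    have hle1 : c ≤ a := hle.1
    have hle2 : d ≤ b := hle.2
    simp only [Finset.coe_erase, Set.mem_sdiff, Finset.mem_coe,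
      YoungDiagram.mem_cells, Set.mem_singleton_iff, Prod.mk.injEq] at hm ⊢
    refine ⟨μ.up_left_mem hle1 hle2 hm.1, ?_⟩
    rintro ⟨rfl, rfl⟩
    have h1 := YoungDiagram.mem_iff_lt_rowLen.mp hm.1
    by_cases hc : c = a
    · subst hc
      apply hm.2
      refine ⟨rfl, by omega⟩
    · have := μ.rowLen_anti (c+1) a (by omega)
      omega

lemma row_lt_card {μ : YoungDiagram} {r : ℕ} (h : 0 < μ.rowLen r) : r < μ.card := by
  have hij' : (r, 0) ∈ μ := by rw [YoungDiagram.mem_iff_lt_rowLen]; exact h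
  have : (Finset.range (r+1)).card ≤ μ.cells.card := by
    refine Finset.card_le_card_of_injOn (fun k => (k, 0)) ?_ ?_
    · intro k hk
      have hk' : k < r + 1 := by simpa using hk
      exact μ.up_left_mem (by omega) le_rfl hij'
    · intro a _ b _ h; simpa using h
  simp at this
  exact this

def Ad (μ : YoungDiagram) : Finset ℕ :=
  (Finset.range (μ.card + 1)).filter (fun r => r = 0 ∨ μ.rowLen r < μ.rowLen (r-1))
def Re (μ : YoungDiagram) : Finset ℕ :=
  (Finset.range (μ.card)).filter (fun r => μ.rowLen (r+1) < μ.rowLen r)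

lemma mem_Ad {μ : YoungDiagram} {r : ℕ} :
    r ∈ Ad μ ↔ (r = 0 ∨ μ.rowLen r < μ.rowLen (r-1)) := by
  simp only [Ad, Finset.mem_filter, Finset.mem_range, and_iff_right_iff_imp]
  rintro (h | h)
  · omega
  · have := row_lt_card (μ := μ) (r := r-1) (by omega)
    omega

lemma mem_Re {μ : YoungDiagram} {r : ℕ} :
    r ∈ Re μ ↔ (μ.rowLen (r+1) < μ.rowLen r) := by
  simp only [Re, Finset.mem_filter, Finset.mem_range, and_iff_right_iff_imp]
  intro h
  exact row_lt_card (by omega)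

lemma card_Ad (μ : YoungDiagram) : (Ad μ).card = (Re μ).card + 1 := by
  have : Ad μ = insert 0 ((Re μ).image Nat.succ) := by
    ext r
    simp only [mem_Ad, Finset.mem_insert, Finset.mem_image, mem_Re]
    rcases r with _ | r
    · simp
    · simp
  rw [this, Finset.card_insert_of_notMem (by simp), Finset.card_image_of_injective _
    Nat.succ_injective]

lemma addRow_mem (μ : YoungDiagram) (r : ℕ) (h) : addRow μ r h ∈ U μ := by
  rw [mem_U]
  constructor
  · intro x hx
    exact Finset.mem_insert_of_mem hx
  · exact Finset.card_insert_of_notMem (by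
      rw [YoungDiagram.mem_cells, YoungDiagram.mem_iff_lt_rowLen]; omega)

lemma remRow_mem (μ : YoungDiagram) (r : ℕ) (h) : remRow μ r h ∈ D μ := by
  rw [mem_D]
  have hm : (r, μ.rowLen r - 1) ∈ μ.cells := by
    rw [YoungDiagram.mem_cells, YoungDiagram.mem_iff_lt_rowLen]; omega
  constructor
  · intro x hx
    exact Finset.mem_of_mem_erase hx
  · exact (Finset.card_erase_add_one hm).symm

lemma card_U (μ : YoungDiagram) : (U μ).card = (Ad μ).card := by
  symm
  refine Finset.card_bij (fun r hr => addRow μ r (mem_Ad.mp hr)) ?_ ?_ ?_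
  · intro r hr; exact addRow_mem _ _ _
  · intro a ha b hb hab
    have h1 : (a, μ.rowLen a) ∈ (addRow μ b (mem_Ad.mp hb)).cells := by
      rw [← hab]; exact Finset.mem_insert_self _ _
    have h2 := Finset.mem_insert.mp h1
    rcases h2 with h2 | h2
    · exact (Prod.mk.inj h2).1
    · rw [YoungDiagram.mem_cells, YoungDiagram.mem_iff_lt_rowLen] at h2; omega
  · intro Λ hΛ
    obtain ⟨⟨r, s⟩, hc, he⟩ := cover_cell hΛ
    have hin : (r, s) ∈ Λ := by
      rw [← YoungDiagram.mem_cells, he]; exact Finset.mem_insert_self _ _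
    have low : ∀ a b, a ≤ r → b ≤ s → (a, b) ≠ (r, s) → (a, b) ∈ μ := by
      intro a b ha hb hne
      have : (a, b) ∈ Λ.cells := Λ.up_left_mem ha hb hin
      rw [he, Finset.mem_insert] at this
      exact this.resolve_left hne
    have hs : s = μ.rowLen r := by
      rw [YoungDiagram.mem_iff_lt_rowLen] at hc
      by_contra hne
      have := low r (s-1) le_rfl (by omega) (by simp; omega)
      rw [YoungDiagram.mem_iff_lt_rowLen] at this
      omega
    subst hs
    have hr : r = 0 ∨ μ.rowLen r < μ.rowLen (r-1) := by
      by_cases h0 : r = 0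
      · exact Or.inl h0
      · right
        have := low (r-1) (μ.rowLen r) (by omega) le_rfl (by simp; omega)
        rwa [YoungDiagram.mem_iff_lt_rowLen] at this
    exact ⟨r, mem_Ad.mpr hr, YoungDiagram.ext he.symm⟩

lemma card_D (μ : YoungDiagram) : (D μ).card = (Re μ).card := by
  symm
  refine Finset.card_bij (fun r hr => remRow μ r (mem_Re.mp hr)) ?_ ?_ ?_
  · intro r hr; exact remRow_mem _ _ _
  · intro a ha b hb hab
    have hma := mem_Re.mp ha
    have h1 : (a, μ.rowLen a - 1) ∉ (remRow μ b (mem_Re.mp hb)).cells := by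
      rw [← hab]; exact Finset.notMem_erase _ _
    by_contra hne
    apply h1
    refine Finset.mem_erase.mpr ⟨by simp [hne], ?_⟩
    rw [YoungDiagram.mem_cells, YoungDiagram.mem_iff_lt_rowLen]; omega
  · intro ν hν
    obtain ⟨⟨r, s⟩, hc, he⟩ := cover_cell (mem_D_iff.mp hν)
    have hin : (r, s) ∈ μ := by
      rw [← YoungDiagram.mem_cells, he]; exact Finset.mem_insert_self _ _
    have high : ∀ a b, r ≤ a → s ≤ b → (a, b) ≠ (r, s) → (a, b) ∉ μ := by
      intro a b ha hb hne hm
      rw [← YoungDiagram.mem_cells, he, Finset.mem_insert] at hm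
      exact hc (ν.up_left_mem ha hb (hm.resolve_left hne))
    have h1 := high (r+1) s (by omega) le_rfl (by simp)
    have h2 := high r (s+1) (by omega) (by omega) (by simp)
    rw [YoungDiagram.mem_iff_lt_rowLen] at h1 h2 hin
    have hs : s = μ.rowLen r - 1 := by omega
    refine ⟨r, mem_Re.mpr (by omega), YoungDiagram.ext ?_⟩
    change μ.cells.erase (r, μ.rowLen r - 1) = ν.cells
    rw [← hs, he]
    exact Finset.erase_insert hc

lemma card_U_eq (μ : YoungDiagram) : (U μ).card = (D μ).card + 1 := by
  rw [card_U, card_D, card_Ad]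

/-! commutation -/
lemma card_sup_inf (μ ν : YoungDiagram) : (μ ⊔ ν).card + (μ ⊓ ν).card = μ.card + ν.card := by
  change (μ ⊔ ν).cells.card + (μ ⊓ ν).cells.card = μ.cells.card + ν.cells.card
  rw [YoungDiagram.cells_sup, YoungDiagram.cells_inf]
  exact Finset.card_union_add_card_inter _ _

lemma eq_of_le_card {μ ν : YoungDiagram} (h : μ ≤ ν) (hc : ν.card ≤ μ.card) : μ = ν :=
  YoungDiagram.ext (Finset.eq_of_subset_of_card_le h hc)

lemma card_mono {μ ν : YoungDiagram} (h : μ ≤ ν) : μ.card ≤ ν.card := Finset.card_le_card h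

open Classical in
lemma comm_ne {μ ν : YoungDiagram} (hne : μ ≠ ν) (hc : μ.card = ν.card) :
    (U μ ∩ U ν).card = (D μ ∩ D ν).card := by
  have hsi := card_sup_inf μ ν
  have hsup : μ.card + 1 ≤ (μ ⊔ ν).card := by
    by_contra hlt
    have e1 : μ = μ ⊔ ν := eq_of_le_card le_sup_left (by omega)
    have e2 : ν = μ ⊔ ν := eq_of_le_card le_sup_right (by omega)
    exact hne (e1.trans e2.symm)
  by_cases h : (μ ⊔ ν).card = μ.card + 1
  · have a : U μ ∩ U ν = {μ ⊔ ν} := by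
      ext Λ
      simp only [Finset.mem_inter, mem_U, Finset.mem_singleton]
      constructor
      · rintro ⟨⟨h1, h2⟩, h3, h4⟩
        exact (eq_of_le_card (sup_le h1 h3) (by omega)).symm
      · rintro rfl
        exact ⟨⟨le_sup_left, by omega⟩, le_sup_right, by omega⟩
    have b : D μ ∩ D ν = {μ ⊓ ν} := by
      ext Λ
      simp only [Finset.mem_inter, mem_D, Finset.mem_singleton]
      constructor
      · rintro ⟨⟨h1, h2⟩, h3, h4⟩
        exact (eq_of_le_card (le_inf h1 h3) (by omega))
      · rintro rfl
        exact ⟨⟨inf_le_left, by omega⟩, inf_le_right, by omega⟩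
    rw [a, b]; simp
  · have a : U μ ∩ U ν = ∅ := by
      ext Λ
      simp only [Finset.mem_inter, mem_U, Finset.notMem_empty, iff_false]
      rintro ⟨⟨h1, h2⟩, h3, h4⟩
      have := card_mono (sup_le h1 h3)
      omega
    have b : D μ ∩ D ν = ∅ := by
      ext Λ
      simp only [Finset.mem_inter, mem_D, Finset.notMem_empty, iff_false]
      rintro ⟨⟨h1, h2⟩, h3, h4⟩
      have := card_mono (le_inf h1 h3)
      omega
    rw [a, b]

open Classical in
lemma sum_UD (f : YoungDiagram → ℕ) (μ : YoungDiagram) :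
    ∑ Λ ∈ U μ, ∑ ν ∈ D Λ, f ν = ∑ κ ∈ D μ, ∑ ν ∈ U κ, f ν + f μ := by
  have e1 : ∑ Λ ∈ U μ, ∑ ν ∈ D Λ, f ν = ∑ ν ∈ Y μ.card, ∑ Λ ∈ U μ ∩ U ν, f ν := by
    apply Finset.sum_comm'
    intro Λ ν
    simp only [mem_U, mem_D, Finset.mem_inter, mem_Y]
    constructor
    · rintro ⟨⟨h1, h2⟩, h3, h4⟩; exact ⟨⟨⟨h1, h2⟩, h3, h4⟩, by omega⟩
    · rintro ⟨⟨⟨h1, h2⟩, h3, h4⟩, _⟩; exact ⟨⟨h1, h2⟩, h3, h4⟩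
  have e2 : ∑ κ ∈ D μ, ∑ ν ∈ U κ, f ν = ∑ ν ∈ Y μ.card, ∑ Λ ∈ D μ ∩ D ν, f ν := by
    apply Finset.sum_comm'
    intro Λ ν
    simp only [mem_U, mem_D, Finset.mem_inter, mem_Y]
    constructor
    · rintro ⟨⟨h1, h2⟩, h3, h4⟩; exact ⟨⟨⟨h1, h2⟩, h3, h4⟩, by omega⟩
    · rintro ⟨⟨⟨h1, h2⟩, h3, h4⟩, _⟩; exact ⟨⟨h1, h2⟩, h3, h4⟩
  have hμ : μ ∈ Y μ.card := mem_Y.mpr rfl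
  rw [e1, e2, ← Finset.add_sum_erase _ _ hμ, ← Finset.add_sum_erase _ _ hμ]
  have e3 : ∑ ν ∈ (Y μ.card).erase μ, ∑ Λ ∈ U μ ∩ U ν, f ν
      = ∑ ν ∈ (Y μ.card).erase μ, ∑ Λ ∈ D μ ∩ D ν, f ν := by
    apply Finset.sum_congr rfl
    intro ν hν
    rw [Finset.mem_erase, mem_Y] at hν
    simp only [Finset.sum_const]
    rw [comm_ne hν.1.symm hν.2.symm]
  rw [e3]
  simp only [Finset.inter_self, Finset.sum_const, card_U_eq, smul_eq_mul]
  ring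

/-! SYT branching -/
def S (μ : YoungDiagram) : Set (ℕ × ℕ → ℕ) :=
  {T | (∀ c, c ∉ μ → T c = 0) ∧ (∀ c, c ∈ μ → T c < μ.card) ∧
    (∀ a b, a ∈ μ → b ∈ μ → T a = T b → a = b) ∧
    ∀ a b, a ∈ μ → b ∈ μ → a ≤ b → a ≠ b → T a < T b}

open Classical in
noncomputable def sytEquiv (μ : YoungDiagram) :
  {T : μ.cells → Fin μ.card //
    Function.Bijective T ∧
      ∀ a b : μ.cells, (a : ℕ × ℕ).1 ≤ (b : ℕ × ℕ).1 → (a : ℕ × ℕ).2 ≤ (b : ℕ × ℕ).2 →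
        a ≠ b → T a < T b} ≃ S μ where
  toFun T := ⟨fun c => if h : c ∈ μ.cells then (T.1 ⟨c, h⟩ : ℕ) else 0, by
    refine ⟨?_, ?_, ?_, ?_⟩
    · intro c hc
      rw [← YoungDiagram.mem_cells] at hc
      simp only [hc, dif_neg, not_false_iff]
    · intro c hc
      rw [← YoungDiagram.mem_cells] at hc
      simp only [hc, dif_pos]
      exact (T.1 ⟨c, hc⟩).2
    · intro a b ha hb h
      rw [← YoungDiagram.mem_cells] at ha hb
      simp only [ha, hb, dif_pos] at h
      exact congrArg Subtype.val (T.2.1.1 (Fin.ext h))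
    · intro a b ha hb hle hne
      rw [← YoungDiagram.mem_cells] at ha hb
      simp only [ha, hb, dif_pos]
      exact T.2.2 ⟨a, ha⟩ ⟨b, hb⟩ hle.1 hle.2 (by simpa using hne)⟩
  invFun T := ⟨fun c => ⟨T.1 c.1, T.2.2.1 c.1 c.2⟩, by
    constructor
    · rw [Fintype.bijective_iff_injective_and_card]
      constructor
      · intro a b h
        exact Subtype.ext (T.2.2.2.1 a.1 b.1 a.2 b.2 (congrArg Fin.val h))
      · simp
    · intro a b h1 h2 hne
      exact T.2.2.2.2 a.1 b.1 a.2 b.2 ⟨h1, h2⟩ (fun h => hne (Subtype.ext h))⟩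
  left_inv T := by
    apply Subtype.ext
    funext c
    apply Fin.ext
    simp
  right_inv T := by
    apply Subtype.ext
    funext c
    by_cases h : c ∈ μ.cells
    · simp only [h, dif_pos]
    · simp only [h, dif_neg, not_false_iff]
      exact (T.2.1 c h).symm

lemma sytCount_eq (μ : YoungDiagram) : sytCount μ = Nat.card (S μ) :=
  Nat.card_congr (sytEquiv μ)

lemma finite_S (μ : YoungDiagram) : (S μ).Finite := by
  classical
  have : Finite (S μ) := Finite.of_equiv _ (sytEquiv μ)
  exact Set.toFinite _

noncomputable def SF (μ : YoungDiagram) : Finset (ℕ × ℕ → ℕ) := (finite_S μ).toFinset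

lemma mem_SF {μ : YoungDiagram} {T} : T ∈ SF μ ↔ T ∈ S μ := by simp [SF]

lemma sytCount_SF (μ : YoungDiagram) : sytCount μ = (SF μ).card := by
  rw [sytCount_eq, SF, Nat.card_coe_set_eq, Set.ncard_eq_toFinset_card _ (finite_S μ)]

open Classical in
noncomputable def exT (Λ μ : YoungDiagram) (T : ℕ × ℕ → ℕ) : ℕ × ℕ → ℕ :=
  fun c => if c ∈ μ then T c else if c ∈ Λ then μ.card else 0

lemma exT_mem {Λ μ : YoungDiagram} (h : μ ∈ D Λ) {T} (hT : T ∈ S μ) : exT Λ μ T ∈ S Λ := by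
  have hc := (mem_D.mp h).2
  have hle : ∀ c, c ∈ μ → c ∈ Λ := fun c hc => (mem_D.mp h).1 hc
  obtain ⟨x, hx, he⟩ := cover_cell (mem_D_iff.mp h)
  have hΛ : ∀ c, c ∈ Λ → c ∉ μ → c = x := by
    intro c h1 h2
    rw [← YoungDiagram.mem_cells, he, Finset.mem_insert] at h1
    exact h1.resolve_right h2
  obtain ⟨t1, t2, t3, t4⟩ := hT
  refine ⟨?_, ?_, ?_, ?_⟩
  · intro c hc
    have : c ∉ μ := fun h => hc (hle c h)
    simp [exT, this, hc]
  · intro c hcΛ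
    by_cases hm : c ∈ μ
    · simp only [exT, hm, if_true]; have := t2 c hm; omega
    · simp only [exT, hm, if_false, hcΛ, if_true]; omega
  · intro a b ha hb hab
    by_cases ma : a ∈ μ <;> by_cases mb : b ∈ μ <;>
      simp only [exT, ma, mb, ha, hb, if_true, if_false] at hab
    · exact t3 a b ma mb hab
    · have := t2 a ma; omega
    · have := t2 b mb; omega
    · rw [hΛ a ha ma, hΛ b hb mb]
  · intro a b ha hb hab hne
    by_cases ma : a ∈ μ <;> by_cases mb : b ∈ μ <;>
      simp only [exT, ma, mb, ha, hb, if_true, if_false]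
    · exact t4 a b ma mb hab hne
    · exact t2 a ma
    · exact absurd (μ.up_left_mem hab.1 hab.2 mb) ma
    · exact absurd ((hΛ a ha ma).trans (hΛ b hb mb).symm) hne

lemma exT_cell {Λ μ : YoungDiagram} (h : μ ∈ D Λ) {T} (hT : T ∈ S μ) (c : ℕ × ℕ) :
    c ∈ μ ↔ c ∈ Λ ∧ exT Λ μ T c < μ.card := by
  constructor
  · intro hm
    refine ⟨(mem_D.mp h).1 hm, ?_⟩
    simp only [exT, hm, if_true]; exact hT.2.1 c hm
  · rintro ⟨h1, h2⟩
    by_contra hm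
    simp only [exT, hm, h1, if_true, if_false] at h2
    omega

lemma exT_surj {Λ : YoungDiagram} (hpos : 0 < Λ.card) {T} (hT : T ∈ S Λ) :
    ∃ μ ∈ D Λ, ∃ T' ∈ S μ, exT Λ μ T' = T := by
  classical
  obtain ⟨t1, t2, t3, t4⟩ := hT
  have him : Λ.cells.image T = Finset.range Λ.card := by
    apply Finset.eq_of_subset_of_card_le
    · intro y hy
      obtain ⟨c, hc, rfl⟩ := Finset.mem_image.mp hy
      exact Finset.mem_range.mpr (t2 c hc)
    · rw [Finset.card_image_of_injOn]
      · simp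
      · intro a ha b hb hab
        exact t3 a b ha hb hab
  have hl : Λ.card - 1 ∈ Λ.cells.image T := by rw [him, Finset.mem_range]; omega
  obtain ⟨x, hx, hTx⟩ := Finset.mem_image.mp hl
  let μ : YoungDiagram :=
    { cells := Λ.cells.erase x
      isLowerSet := by
        intro a b hba ha
        simp only [Finset.coe_erase, Set.mem_sdiff, Finset.mem_coe,
          YoungDiagram.mem_cells, Set.mem_singleton_iff] at ha ⊢
        refine ⟨Λ.up_left_mem hba.1 hba.2 ha.1, ?_⟩
        rintro rfl
        have h1 := t4 b a hx ha.1 hba (fun h => ha.2 h.symm)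
        have h2 := t2 a ha.1
        omega }
  have hμc : ∀ c, c ∈ μ ↔ c ≠ x ∧ c ∈ Λ := fun c => Finset.mem_erase
  have hcard : Λ.card = μ.card + 1 := (Finset.card_erase_add_one hx).symm
  refine ⟨μ, mem_D.mpr ⟨fun c hc => ((hμc c).mp hc).2, hcard⟩,
    fun c => if c ∈ μ then T c else 0, ⟨?_, ?_, ?_, ?_⟩, ?_⟩
  · intro c hc; simp [hc]
  · intro c hc
    simp only [hc, if_true]
    have h1 := (hμc c).mp hc
    have h2 := t2 c h1.2
    have h3 : T c ≠ Λ.card - 1 := fun h => h1.1 (t3 _ _ h1.2 hx (h.trans hTx.symm))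
    omega
  · intro a b ha hb hab
    simp only [ha, hb, if_true] at hab
    exact t3 a b ((hμc a).mp ha).2 ((hμc b).mp hb).2 hab
  · intro a b ha hb hab hne
    simp only [ha, hb, if_true]
    exact t4 a b ((hμc a).mp ha).2 ((hμc b).mp hb).2 hab hne
  · funext c
    by_cases hm : c ∈ μ
    · simp [exT, hm]
    · by_cases hΛ : c ∈ Λ
      · have : c = x := by
          by_contra hne; exact hm ((hμc c).mpr ⟨hne, hΛ⟩)
        simp only [exT, hm, hΛ, if_true, if_false]
        rw [this, hTx]; omega
      · simp only [exT, hm, hΛ, if_false]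
        exact (t1 c hΛ).symm

lemma branching {Λ : YoungDiagram} (hpos : 0 < Λ.card) :
    sytCount Λ = ∑ μ ∈ D Λ, sytCount μ := by
  classical
  have : SF Λ = (D Λ).biUnion (fun μ => (SF μ).image (exT Λ μ)) := by
    ext T
    simp only [Finset.mem_biUnion, Finset.mem_image, mem_SF]
    constructor
    · intro hT; exact exT_surj hpos hT
    · rintro ⟨μ, hμ, T', hT', rfl⟩; exact exT_mem hμ hT'
  rw [sytCount_SF, this, Finset.card_biUnion]
  · apply Finset.sum_congr rfl
    intro μ hμ
    rw [sytCount_SF, Finset.card_image_of_injOn]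
    intro T hT T' hT' h
    have hT := mem_SF.mp hT
    have hT' := mem_SF.mp hT'
    funext c
    by_cases hm : c ∈ μ
    · have := congrFun h c
      simpa [exT, hm] using this
    · rw [hT.1 c hm, hT'.1 c hm]
  · intro μ hμ ν hν hne
    simp only [Function.onFun]
    rw [Finset.disjoint_left]
    intro T h1 h2
    obtain ⟨T1, hT1, e1⟩ := Finset.mem_image.mp h1
    obtain ⟨T2, hT2, e2⟩ := Finset.mem_image.mp h2
    apply hne
    have hc : μ.card = ν.card := by
      have := (mem_D.mp hμ).2; have := (mem_D.mp hν).2; omega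
    apply YoungDiagram.ext
    ext c
    rw [YoungDiagram.mem_cells, YoungDiagram.mem_cells, exT_cell hμ (mem_SF.mp hT1),
      exT_cell hν (mem_SF.mp hT2), e1, e2, hc]

lemma card_zero {μ : YoungDiagram} (h : μ.card = 0) : μ = ⊥ := by
  apply YoungDiagram.ext
  rw [YoungDiagram.cells_bot]
  exact Finset.card_eq_zero.mp h

lemma card_bot' : (⊥ : YoungDiagram).card = 0 := by
  change (⊥ : YoungDiagram).cells.card = 0
  simp

lemma Y_zero : Y 0 = {⊥} := by
  ext μ
  rw [mem_Y, Finset.mem_singleton]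
  exact ⟨card_zero, fun h => h ▸ card_bot'⟩

lemma sytCount_bot : sytCount ⊥ = 1 := by
  rw [sytCount_SF]
  have : SF ⊥ = {fun _ => 0} := by
    ext T
    rw [mem_SF, Finset.mem_singleton]
    constructor
    · intro h; funext c; exact h.1 c (by simp)
    · rintro rfl
      exact ⟨by simp, by simp, by simp, by simp⟩
  rw [this]; simp

lemma sum_up (n : ℕ) : ∀ μ : YoungDiagram, μ.card = n →
    ∑ Λ ∈ U μ, sytCount Λ = (n + 1) * sytCount μ := by
  induction n with
  | zero =>
    intro μ hμ
    have h1 : ∑ Λ ∈ U μ, sytCount Λ = ∑ Λ ∈ U μ, ∑ ν ∈ D Λ, sytCount ν :=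
      Finset.sum_congr rfl fun Λ h => branching (by have := (mem_U.mp h).2; omega)
    have h2 : D μ = ∅ := by
      ext ν; simp only [mem_D, Finset.notMem_empty, iff_false]; omega
    rw [h1, sum_UD, h2]; simp
  | succ n ih =>
    intro μ hμ
    have h1 : ∑ Λ ∈ U μ, sytCount Λ = ∑ Λ ∈ U μ, ∑ ν ∈ D Λ, sytCount ν :=
      Finset.sum_congr rfl fun Λ h => branching (by have := (mem_U.mp h).2; omega)
    have h2 : ∑ κ ∈ D μ, ∑ ν ∈ U κ, sytCount ν = ∑ κ ∈ D μ, (n + 1) * sytCount κ :=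
      Finset.sum_congr rfl fun Λ h => ih Λ (by have := (mem_D.mp h).2; omega)
    rw [h1, sum_UD, h2, ← Finset.mul_sum, ← branching (by omega)]
    ring

/-- swapping -/
lemma sum_swap {M : Type*} [AddCommMonoid M] (n : ℕ) (f : YoungDiagram → YoungDiagram → M) :
    ∑ μ ∈ Y n, ∑ Λ ∈ U μ, f μ Λ = ∑ Λ ∈ Y (n+1), ∑ μ ∈ D Λ, f μ Λ := by
  apply Finset.sum_comm'
  intro μ Λ
  simp only [mem_Y, mem_U, mem_D]
  constructor
  · rintro ⟨h1, h2, h3⟩; exact ⟨⟨h2, h3⟩, by omega⟩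
  · rintro ⟨⟨h2, h3⟩, h1⟩; exact ⟨by omega, h2, h3⟩

lemma sum_sq (n : ℕ) : ∑ μ ∈ Y n, sytCount μ * sytCount μ = n.factorial := by
  induction n with
  | zero => rw [Y_zero]; simp [sytCount_bot]
  | succ n ih =>
    have h1 : ∑ Λ ∈ Y (n+1), sytCount Λ * sytCount Λ
        = ∑ Λ ∈ Y (n+1), ∑ μ ∈ D Λ, sytCount μ * sytCount Λ := by
      apply Finset.sum_congr rfl
      intro Λ hΛ
      rw [← Finset.sum_mul, ← branching (by have := mem_Y.mp hΛ; omega)]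
    rw [h1, ← sum_swap, Nat.factorial_succ, ← ih, Finset.mul_sum]
    apply Finset.sum_congr rfl
    intro μ hμ
    rw [← Finset.mul_sum, sum_up n μ (mem_Y.mp hμ)]
    ring

/-! paths -/
def ext1 (n : ℕ) (p : ℕ → YoungDiagram) (Λ : YoungDiagram) : ℕ → YoungDiagram :=
  fun i => if i ≤ n then p i else Λ

open Classical in
noncomputable def Pa : ℕ → Finset (ℕ → YoungDiagram)
  | 0 => {fun _ => ⊥}
  | n + 1 => (Pa n).biUnion (fun p => (U (p n)).image (ext1 n p))

lemma Pa_const {n : ℕ} : ∀ {p}, p ∈ Pa n → ∀ i, n ≤ i → p i = p n := by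
  induction n with
  | zero => intro p hp; simp [Pa] at hp; subst hp; simp
  | succ n ih =>
    intro p hp i hi
    simp only [Pa, Finset.mem_biUnion, Finset.mem_image] at hp
    obtain ⟨q, hq, Λ, hΛ, rfl⟩ := hp
    have : ¬ i ≤ n := by omega
    simp [ext1, this]

lemma Pa_legal {n : ℕ} : ∀ {p}, p ∈ Pa n → p 0 = ⊥ ∧
    ∀ i, i < n → p i ≤ p (i + 1) ∧ (p (i + 1)).card = (p i).card + 1 := by
  induction n with
  | zero => intro p hp; simp [Pa] at hp; subst hp; simp
  | succ n ih =>
    intro p hp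
    simp only [Pa, Finset.mem_biUnion, Finset.mem_image] at hp
    obtain ⟨q, hq, Λ, hΛ, rfl⟩ := hp
    obtain ⟨h0, h1⟩ := ih hq
    refine ⟨by simp [ext1, h0], ?_⟩
    intro i hi
    by_cases hin : i < n
    · have a : i ≤ n := by omega
      have b : i + 1 ≤ n := by omega
      simp only [ext1, a, b, if_true]
      exact h1 i hin
    · have a : i = n := by omega
      subst a
      simp only [ext1, le_refl, if_true]
      rw [if_neg (by omega)]
      exact mem_U.mp hΛ

/-- Paths agreeing up to n are equal. -/
lemma Pa_inj {n : ℕ} {p q} (hp : p ∈ Pa n) (hq : q ∈ Pa n) (h : ∀ i ≤ n, p i = q i) : p = q := by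
  funext i
  by_cases hi : i ≤ n
  · exact h i hi
  · rw [Pa_const hp i (by omega), Pa_const hq i (by omega), h n le_rfl]

lemma sum_Pa_succ {M : Type*} [AddCommMonoid M] (n : ℕ) (g : YoungDiagram → YoungDiagram → M) :
    ∑ p ∈ Pa (n+1), g (p n) (p (n+1)) = ∑ p ∈ Pa n, ∑ Λ ∈ U (p n), g (p n) Λ := by
  classical
  rw [Pa, Finset.sum_biUnion]
  · apply Finset.sum_congr rfl
    intro p hp
    rw [Finset.sum_image]
    · apply Finset.sum_congr rfl
      intro Λ hΛ
      simp [ext1]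
    · intro a _ b _ h
      have := congrFun h (n+1)
      simpa [ext1] using this
  · intro p hp q hq hne
    simp only [Function.onFun]
    rw [Finset.disjoint_left]
    intro s h1 h2
    obtain ⟨a, ha, e1⟩ := Finset.mem_image.mp h1
    obtain ⟨b, hb, e2⟩ := Finset.mem_image.mp h2
    apply hne
    apply Pa_inj hp hq
    intro i hi
    have := congrFun (e1.trans e2.symm) i
    simpa [ext1, hi] using this

lemma sum_Pa {M : Type*} [AddCommMonoid M] (n : ℕ) : ∀ (g : YoungDiagram → M),
    ∑ p ∈ Pa n, g (p n) = ∑ μ ∈ Y n, sytCount μ • g μ := by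
  induction n with
  | zero => intro g; simp [Pa, Y_zero, sytCount_bot]
  | succ n ih =>
    intro g
    rw [sum_Pa_succ n (fun _ Λ => g Λ), ih (fun μ => ∑ Λ ∈ U μ, g Λ)]
    simp only [Finset.smul_sum]
    rw [sum_swap]
    apply Finset.sum_congr rfl
    intro Λ hΛ
    rw [← Finset.sum_smul, ← branching (by have := mem_Y.mp hΛ; omega)]

open Classical in
/-- the Cauchy-Schwarz bound -/
lemma cs_bound (n r : ℕ) :
    ∑ μ ∈ Y n, ∑ Λ ∈ U μ, (if Λ.rowLen r = μ.rowLen r + 1 then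
      (sytCount μ : ℝ) * sytCount Λ else 0)
      ≤ Real.sqrt (n.factorial) * Real.sqrt ((n+1).factorial) := by
  let Q : Finset (Σ _ : YoungDiagram, YoungDiagram) :=
    ((Y n).sigma U).filter (fun x => x.2.rowLen r = x.1.rowLen r + 1)
  have e : ∑ μ ∈ Y n, ∑ Λ ∈ U μ, (if Λ.rowLen r = μ.rowLen r + 1 then
      (sytCount μ : ℝ) * sytCount Λ else 0) = ∑ x ∈ Q, (sytCount x.1 : ℝ) * sytCount x.2 := by
    rw [Finset.sum_filter, Finset.sum_sigma]
  have hQ : ∀ x ∈ Q, x.1 ∈ Y n ∧ x.2 ∈ U x.1 ∧ x.2.rowLen r = x.1.rowLen r + 1 := by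
    intro x hx
    simp only [Q, Finset.mem_filter, Finset.mem_sigma] at hx
    exact ⟨hx.1.1, hx.1.2, hx.2⟩
  have sq : ∀ m, ∑ μ ∈ Y m, (sytCount μ : ℝ)^2 = m.factorial := by
    intro m
    rw [← sum_sq m]; push_cast
    simp only [pow_two]
  have b1 : ∑ x ∈ Q, (sytCount x.1 : ℝ)^2 ≤ n.factorial := by
    rw [← sq n, ← Finset.sum_image (s := Q) (g := fun x => x.1)
      (f := fun μ => (sytCount μ : ℝ)^2)]
    · apply Finset.sum_le_sum_of_subset_of_nonneg
      · intro μ hμ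
        obtain ⟨x, hx, rfl⟩ := Finset.mem_image.mp hμ
        exact (hQ x hx).1
      · intros; positivity
    · rintro ⟨a, b⟩ hx ⟨a', b'⟩ hy h
      simp only at h
      subst h
      have h1 := hQ _ hx
      have h2 := hQ _ hy
      have := row_up_unique h1.2.1 h2.2.1 h1.2.2 h2.2.2
      simp only at this
      rw [this]
  have b2 : ∑ x ∈ Q, (sytCount x.2 : ℝ)^2 ≤ (n+1).factorial := by
    rw [← sq (n+1), ← Finset.sum_image (s := Q) (g := fun x => x.2)
      (f := fun μ => (sytCount μ : ℝ)^2)]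
    · apply Finset.sum_le_sum_of_subset_of_nonneg
      · intro μ hμ
        obtain ⟨x, hx, rfl⟩ := Finset.mem_image.mp hμ
        have h1 := mem_Y.mp (hQ x hx).1
        have h2 := mem_U.mp (hQ x hx).2.1
        rw [mem_Y]; omega
      · intros; positivity
    · rintro ⟨a, b⟩ hx ⟨a', b'⟩ hy h
      simp only at h
      subst h
      have h1 := hQ _ hx
      have h2 := hQ _ hy
      have := row_down_unique h1.2.1 h2.2.1 h1.2.2 h2.2.2
      simp only at this
      rw [this]
  rw [e]
  refine (Real.sum_mul_le_sqrt_mul_sqrt Q _ _).trans ?_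
  gcongr

end PGP
open PGP

theorem growth_prob_le {Ω : Type*} [MeasurableSpace Ω] (P : Measure Ω)
    (lam : ℕ → Ω → YoungDiagram) (hPGP : IsPlancherelGrowthProcess P lam) (r : ℕ) :
    ∀ n : ℕ, (P (growthEvent lam n r)).toReal ≤ 1 / Real.sqrt (n + 1) := by
  classical
  obtain ⟨hP, hmeas, hpath⟩ := hPGP
  intro n
  let B : (ℕ → YoungDiagram) → Set Ω := fun p => {ω | ∀ i ≤ n + 1, lam i ω = p i}
  have hBm : ∀ p, MeasurableSet (B p) := by
    intro p
    have : B p = ⋂ i, ⋂ (_ : i ≤ n + 1), {ω | lam i ω = p i} := by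
      ext ω; simp [B]
    rw [this]
    exact MeasurableSet.iInter fun i => MeasurableSet.iInter fun _ => hmeas i _
  have hBP : ∀ p ∈ Pa (n+1), P.real (B p) = (sytCount (p (n+1)) : ℝ) / (n+1).factorial := by
    intro p hp
    have h := Pa_legal hp
    rw [Measure.real, hpath (n+1) p h.1 h.2]
    simp
  have hdisj : Set.PairwiseDisjoint (↑(Pa (n+1)) : Set (ℕ → YoungDiagram)) B := by
    intro p hp q hq hne
    simp only [Function.onFun]
    rw [Set.disjoint_left]
    intro ω h1 h2
    exact hne (Pa_inj hp hq fun i hi => (h1 i hi).symm.trans (h2 i hi))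
  have htot : P.real (⋃ p ∈ Pa (n+1), B p) = 1 := by
    rw [measureReal_biUnion_finset hdisj (fun p _ => hBm p), Finset.sum_congr rfl hBP,
      sum_Pa (n+1) (fun Λ => (sytCount Λ : ℝ) / (n+1).factorial)]
    have := sum_sq (n+1)
    have h2 : ∑ μ ∈ Y (n+1), (sytCount μ : ℝ) * sytCount μ = (n+1).factorial := by
      rw [← this]; push_cast; rfl
    simp only [nsmul_eq_mul, ← mul_div_assoc]
    rw [← Finset.sum_div, h2, div_self (by positivity)]
  have hcompl : P.real (⋃ p ∈ Pa (n+1), B p)ᶜ = 0 := by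
    rw [probReal_compl_eq_one_sub (Finset.measurableSet_biUnion _ fun p _ => hBm p), htot]
    simp
  let G := (Pa (n+1)).filter (fun p => (p (n+1)).rowLen r = (p n).rowLen r + 1)
  have hsub : growthEvent lam n r ⊆ (⋃ p ∈ Pa (n+1), B p)ᶜ ∪ ⋃ p ∈ G, B p := by
    intro ω hω
    by_cases h : ω ∈ ⋃ p ∈ Pa (n+1), B p
    · right
      simp only [Set.mem_iUnion] at h ⊢
      obtain ⟨p, hp, hb⟩ := h
      refine ⟨p, ?_, hb⟩
      simp only [G, Finset.mem_filter]
      refine ⟨hp, ?_⟩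
      rw [← hb n (by omega), ← hb (n+1) le_rfl]
      exact hω
    · left; exact h
  have hsum : P.real (growthEvent lam n r) ≤ ∑ p ∈ G, P.real (B p) := by
    calc P.real (growthEvent lam n r) ≤ _ := measureReal_mono hsub
      _ ≤ _ := measureReal_union_le _ _
      _ = P.real (⋃ p ∈ G, B p) := by rw [hcompl, zero_add]
      _ ≤ _ := measureReal_biUnion_finset_le _ _
  have hval : ∑ p ∈ G, P.real (B p) = (∑ μ ∈ Y n, ∑ Λ ∈ U μ,
      (if Λ.rowLen r = μ.rowLen r + 1 then (sytCount μ : ℝ) * sytCount Λ else 0))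
        / (n+1).factorial := by
    rw [Finset.sum_filter]
    obtain ⟨g, hg⟩ : ∃ g : YoungDiagram → YoungDiagram → ℝ, ∀ μ Λ, g μ Λ =
        if Λ.rowLen r = μ.rowLen r + 1 then (sytCount Λ : ℝ) / (n+1).factorial else 0 :=
      ⟨_, fun _ _ => rfl⟩
    have : ∀ p ∈ Pa (n+1), (if (p (n+1)).rowLen r = (p n).rowLen r + 1 then P.real (B p) else 0)
        = g (p n) (p (n+1)) := by
      intro p hp
      rw [hg, hBP p hp]
    rw [Finset.sum_congr rfl this, sum_Pa_succ n g, sum_Pa n (fun μ => ∑ Λ ∈ U μ, g μ Λ),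
      Finset.sum_div]
    apply Finset.sum_congr rfl
    intro μ _
    rw [Finset.smul_sum, Finset.sum_div]
    apply Finset.sum_congr rfl
    intro Λ _
    rw [hg]
    split_ifs
    · simp only [nsmul_eq_mul, mul_div_assoc]
    · simp
  change P.real (growthEvent lam n r) ≤ _
  rw [hval] at hsum
  refine hsum.trans ?_
  have hcs := cs_bound n r
  have hf : (0:ℝ) < (n.factorial : ℝ) := by positivity
  have hn : (0:ℝ) < (n:ℝ) + 1 := by positivity
  have hfs : ((n+1).factorial : ℝ) = (n + 1) * n.factorial := by
    rw [Nat.factorial_succ]; push_cast; ring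
  rw [div_le_div_iff₀ (by positivity) (by positivity), one_mul]
  calc _ ≤ Real.sqrt (n.factorial) * Real.sqrt ((n+1).factorial) * Real.sqrt (n+1) := by
        gcongr
    _ = ((n+1).factorial : ℝ) := by
        rw [hfs, Real.sqrt_mul hn.le]
        have a := Real.mul_self_sqrt hf.le
        have b := Real.mul_self_sqrt hn.le
        calc _ = (Real.sqrt (n+1) * Real.sqrt (n+1)) * (Real.sqrt (n.factorial) * Real.sqrt (n.factorial)) := by ring
          _ = _ := by rw [a, b]
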